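/- arXiv:1505.00870 — 2 statements merged into one kernel-verified Lean document; each statement's English description precedes it below -/
import Mathlib

section
/- Assume z, w ∈ T, w ≠ 0, ⟨w, z⟩ > ε, and w = w_{𝒢(z)}. Let x* = P_{H(w,ε) ∩ T}(z), set 𝒢* = 𝒢(x*), and let (λ*, v*) be a KKT pair for x*. If λ is a real number with r ≤ λ ≤ λ* (in particular r < ∞), then 𝒢(z − λw) ≼ 𝒢* and |𝒢(z_{𝒢(z − λw)})| ≤ |𝒢(z)| − 1. -/
open Finset

/-- The monotone nonnegative cone `T = {x : x₁ ≥ x₂ ≥ ⋯ ≥ xₙ ≥ 0}`. -/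
def coneT (n : ℕ) : Set (Fin n → ℝ) := {x | Antitone x ∧ ∀ i, 0 ≤ x i}

/-- Euclidean inner product on `Fin n → ℝ`. -/
def dot {n : ℕ} (x y : Fin n → ℝ) : ℝ := ∑ i, x i * y i

/-- `x` is the Euclidean projection of `z` onto `C` (minimizer of the distance to `z` over `C`). -/
def IsProjOn {n : ℕ} (C : Set (Fin n → ℝ)) (z x : Fin n → ℝ) : Prop :=
  x ∈ C ∧ ∀ y ∈ C, ∑ i, (x i - z i) ^ 2 ≤ ∑ i, (y i - z i) ^ 2

/-- The ordered weighted ℓ₁ (OWL) norm `Ω_w(x) = ∑ᵢ wᵢ |x|_[i]`,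
where `|x|_[i]` is the i-th largest entry of `(|x₁|, …, |xₙ|)`. -/
noncomputable def owl {n : ℕ} (w x : Fin n → ℝ) : ℝ :=
  ∑ i : Fin n, w i * |x ((Tuple.sort fun j => |x j|) i.rev)|

/-- The closed OWL norm ball `B(w, ε)`. -/
def owlBall {n : ℕ} (w : Fin n → ℝ) (ε : ℝ) : Set (Fin n → ℝ) := {x | owl w x ≤ ε}

/-- The half-space `L(w, ε) = {x : ⟨w, x⟩ ≤ ε}`. -/
def halfSpace {n : ℕ} (w : Fin n → ℝ) (ε : ℝ) : Set (Fin n → ℝ) := {x | dot w x ≤ ε}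

/-- The hyperplane `H(w, ε) = {x : ⟨w, x⟩ = ε}`. -/
def hyperplane {n : ℕ} (w : Fin n → ℝ) (ε : ℝ) : Set (Fin n → ℝ) := {x | dot w x = ε}

/-- `P ∈ 𝒫ₙ`: a partition of `{0, …, n-1}` all of whose blocks are intervals. -/
def IsIntervalPartition {n : ℕ} (P : Finset (Finset (Fin n))) : Prop :=
  (∀ G ∈ P, G.Nonempty) ∧
  (∀ i : Fin n, ∃! G, G ∈ P ∧ i ∈ G) ∧
  (∀ G ∈ P, ∀ i ∈ G, ∀ k ∈ G, ∀ j : Fin n, i ≤ j → j ≤ k → j ∈ G)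

/-- `P ≼ Q`: every block of `P` is contained in some block of `Q`. -/
def Refines {n : ℕ} (P Q : Finset (Finset (Fin n))) : Prop :=
  ∀ G ∈ P, ∃ H ∈ Q, G ⊆ H

/-- `i` and `j` lie in a common block of `P`. -/
def SameBlock {n : ℕ} (P : Finset (Finset (Fin n))) (i j : Fin n) : Prop :=
  ∃ G ∈ P, i ∈ G ∧ j ∈ G

/-- `P = 𝒢(z)`: the partition of indices into maximal intervals of nondecreasing
components of `z`; consecutive indices lie in the same block iff `zᵢ ≤ zᵢ₊₁`. -/
def IsGroupPartition {n : ℕ} (z : Fin n → ℝ) (P : Finset (Finset (Fin n))) : Prop :=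
  IsIntervalPartition P ∧
  ∀ (i : Fin n) (h : i.val + 1 < n),
    (SameBlock P i ⟨i.val + 1, h⟩ ↔ z i ≤ z ⟨i.val + 1, h⟩)

/-- `v = z_P`: the vector obtained from `z` by averaging over the blocks of `P`. -/
def IsAvg {n : ℕ} (P : Finset (Finset (Fin n))) (z v : Fin n → ℝ) : Prop :=
  ∀ G ∈ P, ∀ i ∈ G, v i = (∑ k ∈ G, z k) / (G.card : ℝ)

/-- `(lam, v)` is a KKT pair for `x` in the reduced problem
`min ½‖x − z‖² s.t. ⟨w, x⟩ = ε, x ∈ T`. -/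
def IsKKT {n : ℕ} (z w : Fin n → ℝ) (ε : ℝ) (x : Fin n → ℝ) (lam : ℝ)
    (v : Fin n → ℝ) : Prop :=
  0 < lam ∧ (∀ i, 0 ≤ v i) ∧ x ∈ coneT n ∧
  (∀ (i : Fin n) (h : i.val + 1 < n), v i * (x i - x ⟨i.val + 1, h⟩) = 0) ∧
  (∀ h : 0 < n, v ⟨n - 1, Nat.sub_lt h one_pos⟩ * x ⟨n - 1, Nat.sub_lt h one_pos⟩ = 0) ∧
  (∀ i : Fin n, x i = z i - lam * w i + v i -
    (if _ : i.val = 0 then 0 else v ⟨i.val - 1, lt_of_le_of_lt (Nat.sub_le _ _) i.isLt⟩)) ∧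
  dot w x = ε

/-- The last index `n - 1` of `Fin n`. -/
def lastIdx {n : ℕ} (hn : 0 < n) : Fin n := ⟨n - 1, Nat.sub_lt hn one_pos⟩

/-- `r = min {(zᵢ − zᵢ₊₁)/(wᵢ − wᵢ₊₁)}` in the extended reals, with `0/0 = ∞`, `a/0 = ∞`. -/
noncomputable def rmin {n : ℕ} (z w : Fin n → ℝ) : EReal :=
  ⨅ i : Fin n,
    if h : i.val + 1 < n then
      (if w i - w ⟨i.val + 1, h⟩ = 0 then (⊤ : EReal)
       else (((z i - z ⟨i.val + 1, h⟩) / (w i - w ⟨i.val + 1, h⟩) : ℝ) : EReal))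
    else ⊤

/-- `λ₁ = (⟨z, w⟩ − ε)/‖w‖²`. -/
noncomputable def lam1 {n : ℕ} (z w : Fin n → ℝ) (ε : ℝ) : ℝ :=
  (dot z w - ε) / dot w w

/-- `λ₀ = ((Σ_{i : zᵢ > zₙ} zᵢwᵢ) − ε)/(Σ_{i : zᵢ > zₙ} wᵢ²)`. -/
noncomputable def lam0 {n : ℕ} (hn : 0 < n) (z w : Fin n → ℝ) (ε : ℝ) : ℝ :=
  ((∑ i ∈ Finset.univ.filter (fun i => z (lastIdx hn) < z i), z i * w i) - ε) /
    (∑ i ∈ Finset.univ.filter (fun i => z (lastIdx hn) < z i), w i ^ 2)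

/-- `n' = min({k : z_k − λ₀ w_k < 0} ∪ {n+1})`, with 1-based indexing `k = i + 1`. -/
noncomputable def nprime {n : ℕ} (z w : Fin n → ℝ) (l0 : ℝ) : ℕ :=
  sInf {k | k = n + 1 ∨ ∃ i : Fin n, i.val + 1 = k ∧ z i - l0 * w i < 0}

/-- Componentwise sign, with the convention `sgn 0 = 1`. -/
noncomputable def sgn (t : ℝ) : ℝ := if t < 0 then -1 else 1

/-- The simplex `Δ(κ, n) = {x : x ≥ 0, Σ xᵢ = κ}`. -/
def simplexSet (κ : ℝ) (n : ℕ) : Set (Fin n → ℝ) :=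
  {x | (∀ i, 0 ≤ x i) ∧ ∑ i, x i = κ}


theorem SameBlock.symm {n : ℕ} {P : Finset (Finset (Fin n))} {i j : Fin n}
    (h : SameBlock P i j) : SameBlock P j i :=
  let ⟨G, hG, hi, hj⟩ := h
  ⟨G, hG, hj, hi⟩

theorem IsIntervalPartition.eq_of_mem {n : ℕ} {P : Finset (Finset (Fin n))}
    (hP : IsIntervalPartition P) {G H : Finset (Fin n)} (hG : G ∈ P) (hH : H ∈ P)
    {i : Fin n} (hiG : i ∈ G) (hiH : i ∈ H) : G = H :=
  (hP.2.1 i).unique ⟨hG, hiG⟩ ⟨hH, hiH⟩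

theorem IsIntervalPartition.exists_block {n : ℕ} {P : Finset (Finset (Fin n))}
    (hP : IsIntervalPartition P) (i : Fin n) : ∃ G ∈ P, i ∈ G :=
  let ⟨G, h, _⟩ := hP.2.1 i
  ⟨G, h⟩

theorem IsIntervalPartition.mem_of_sameBlock {n : ℕ} {P : Finset (Finset (Fin n))}
    (hP : IsIntervalPartition P) {H : Finset (Fin n)} (hH : H ∈ P) {i j : Fin n}
    (hij : SameBlock P i j) (hi : i ∈ H) : j ∈ H := by
  obtain ⟨G, hG, hiG, hjG⟩ := hij
  rwa [← hP.eq_of_mem hG hH hiG hi]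

/-- Refinement of interval partitions can be tested on consecutive indices. -/
theorem IsIntervalPartition.refines_of_consecutive {n : ℕ} {P Q : Finset (Finset (Fin n))}
    (hP : IsIntervalPartition P) (hQ : IsIntervalPartition Q)
    (h : ∀ (i : Fin n) (hi : i.val + 1 < n),
      SameBlock P i ⟨i.val + 1, hi⟩ → SameBlock Q i ⟨i.val + 1, hi⟩) :
    Refines P Q := by
  intro G hG
  set a := G.min' (hP.1 G hG) with ha
  have haG : a ∈ G := G.min'_mem _
  obtain ⟨H, hH, haH⟩ := hQ.exists_block a
  refine ⟨H, hH, fun b hb => ?_⟩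
  have key : ∀ m : ℕ, a.val ≤ m → ∀ hm : m < n, (⟨m, hm⟩ : Fin n) ∈ G → ⟨m, hm⟩ ∈ H := by
    intro m hm
    induction m, hm using Nat.le_induction with
    | base => exact fun _ _ => haH
    | succ m ham ih =>
      intro hm hmG
      have hmG' : (⟨m, by omega⟩ : Fin n) ∈ G :=
        hP.2.2 G hG a haG _ hmG _ ham (Nat.le_succ m)
      exact hQ.mem_of_sameBlock hH (h ⟨m, by omega⟩ hm ⟨G, hG, hmG', hmG⟩) (ih (by omega) hmG')
  exact key b.val (G.min'_le b hb) b.isLt hb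

theorem Refines.sub_of_mem {n : ℕ} {P Q : Finset (Finset (Fin n))} (h : Refines P Q)
    (hQ : IsIntervalPartition Q) {G H : Finset (Fin n)} (hG : G ∈ P) (hH : H ∈ Q)
    {i : Fin n} (hiG : i ∈ G) (hiH : i ∈ H) : G ⊆ H := by
  obtain ⟨H', hH', hsub⟩ := h G hG
  rwa [hQ.eq_of_mem hH hH' hiH (hsub hiG)]

theorem IsIntervalPartition.card_le_of_forall_exists_subset {n : ℕ}
    {P Q S : Finset (Finset (Fin n))} (hP : IsIntervalPartition P) (hQ : IsIntervalPartition Q)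
    (hS : S ⊆ P) (h : ∀ H ∈ Q, ∃ G ∈ S, G ⊆ H) : Q.card ≤ S.card := by
  choose! f hfS hfH using h
  refine Finset.card_le_card_of_injOn f hfS fun H hH K hK hHK => ?_
  obtain ⟨i, hi⟩ := hP.1 _ (hS (hfS H hH))
  exact hQ.eq_of_mem hH hK (hfH H hH hi) (hfH K hK (hHK ▸ hi))

theorem Refines.card_le {n : ℕ} {P Q : Finset (Finset (Fin n))} (h : Refines P Q)
    (hP : IsIntervalPartition P) (hQ : IsIntervalPartition Q) : Q.card ≤ P.card := by
  refine hP.card_le_of_forall_exists_subset hQ subset_rfl fun H hH => ?_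
  obtain ⟨i, hi⟩ := hQ.1 H hH
  obtain ⟨G, hG, hiG⟩ := hP.exists_block i
  exact ⟨G, hG, h.sub_of_mem hQ hG hH hiG hi⟩

theorem Refines.card_lt {n : ℕ} {P Q : Finset (Finset (Fin n))} (h : Refines P Q)
    (hP : IsIntervalPartition P) (hQ : IsIntervalPartition Q) {i j : Fin n}
    (hijP : ¬ SameBlock P i j) (hijQ : SameBlock Q i j) : Q.card < P.card := by
  obtain ⟨A, hA, hiA⟩ := hP.exists_block i
  obtain ⟨B, hB, hjB⟩ := hP.exists_block j
  have hAB : A ≠ B := by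
    rintro rfl
    exact hijP ⟨A, hA, hiA, hjB⟩
  refine lt_of_le_of_lt ?_ (Finset.card_erase_lt_of_mem hB)
  refine hP.card_le_of_forall_exists_subset hQ (Finset.erase_subset _ _) fun H hH => ?_
  obtain ⟨k, hk⟩ := hQ.1 H hH
  obtain ⟨G, hG, hkG⟩ := hP.exists_block k
  have hGH := h.sub_of_mem hQ hG hH hkG hk
  by_cases hGB : G = B
  · subst hGB
    have hiH := hQ.mem_of_sameBlock hH hijQ.symm (hGH hjB)
    exact ⟨A, Finset.mem_erase.2 ⟨hAB, hA⟩, h.sub_of_mem hQ hA hH hiA hiH⟩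
  · exact ⟨G, Finset.mem_erase.2 ⟨hGB, hG⟩, hGH⟩

theorem IsAvg.eq_of_sameBlock {n : ℕ} {P : Finset (Finset (Fin n))} {z v : Fin n → ℝ}
    (h : IsAvg P z v) {i j : Fin n} (hij : SameBlock P i j) : v i = v j := by
  obtain ⟨G, hG, hi, hj⟩ := hij
  rw [h G hG i hi, h G hG j hj]

theorem exists_ratio_le_of_rmin_le {n : ℕ} (hn : 0 < n) {z w : Fin n → ℝ} {lam : ℝ}
    (h : rmin z w ≤ (lam : EReal)) :
    ∃ (i : Fin n) (hi : i.val + 1 < n), w i - w ⟨i.val + 1, hi⟩ ≠ 0 ∧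
      (z i - z ⟨i.val + 1, hi⟩) / (w i - w ⟨i.val + 1, hi⟩) ≤ lam := by
  have : Nonempty (Fin n) := ⟨⟨0, hn⟩⟩
  obtain ⟨i, hi⟩ := exists_eq_ciInf_of_finite (f := fun i : Fin n =>
    if h : i.val + 1 < n then
      (if w i - w ⟨i.val + 1, h⟩ = 0 then (⊤ : EReal)
       else (((z i - z ⟨i.val + 1, h⟩) / (w i - w ⟨i.val + 1, h⟩) : ℝ) : EReal))
    else ⊤)
  rw [rmin, ← hi] at h
  split_ifs at h with h₁ h₂
  · exact absurd h (not_le.2 (EReal.coe_lt_top lam))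
  · exact ⟨i, h₁, h₂, EReal.coe_le_coe_iff.1 h⟩
  · exact absurd h (not_le.2 (EReal.coe_lt_top lam))

/-- Where `x` drops strictly, the multiplier vanishes, so `z - lam • w` drops at least as much. -/
theorem IsKKT.sub_le_of_lt {n : ℕ} {z w x v : Fin n → ℝ} {ε lam : ℝ}
    (h : IsKKT z w ε x lam v) (i : Fin n) (hi : i.val + 1 < n)
    (hx : x ⟨i.val + 1, hi⟩ < x i) :
    x i - x ⟨i.val + 1, hi⟩ ≤
      (z i - lam * w i) - (z ⟨i.val + 1, hi⟩ - lam * w ⟨i.val + 1, hi⟩) := by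
  obtain ⟨-, hv, -, hcomp, -, hstat, -⟩ := h
  have hvi : v i = 0 := (mul_eq_zero.1 (hcomp i hi)).resolve_right (sub_pos.2 hx).ne'
  have h₁ := hstat i
  have h₂ := hstat ⟨i.val + 1, hi⟩
  simp only [Nat.add_eq_zero_iff, one_ne_zero, and_false, dite_false, Nat.add_sub_cancel,
    Fin.eta] at h₂
  have h₃ := hv ⟨i.val + 1, hi⟩
  split_ifs at h₁ with h₀
  · linarith
  · have := hv ⟨i.val - 1, lt_of_le_of_lt (Nat.sub_le _ _) i.isLt⟩
    linarith

/-- If `r ≤ λ ≤ λ*`, then `𝒢(z − λw) ≼ 𝒢*` and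
`|𝒢(z_{𝒢(z − λw)})| ≤ |𝒢(z)| − 1`. -/
theorem partition_shrinks {n : ℕ} (hn : 0 < n) (ε : ℝ) (hε : 0 < ε)
    (w : Fin n → ℝ) (hw_anti : Antitone w) (hw_nonneg : ∀ i, 0 ≤ w i) (hw_ne : w ≠ 0)
    (z : Fin n → ℝ) (hz : z ∈ coneT n) (hw : w ∈ coneT n) (hzw : ε < dot w z)
    (Gz : Finset (Finset (Fin n))) (hGz : IsGroupPartition z Gz) (hwG : IsAvg Gz w w)
    (xs : Fin n → ℝ) (hxs : IsProjOn (hyperplane w ε ∩ coneT n) z xs)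
    (Gs : Finset (Finset (Fin n))) (hGs : IsGroupPartition xs Gs)
    (lamstar : ℝ) (vstar : Fin n → ℝ) (hKKT : IsKKT z w ε xs lamstar vstar)
    (lam : ℝ) (hrlam : rmin z w ≤ (lam : EReal)) (hlam : lam ≤ lamstar)
    (G1 : Finset (Finset (Fin n))) (hG1 : IsGroupPartition (fun i => z i - lam * w i) G1)
    (za : Fin n → ℝ) (hza : IsAvg G1 z za)
    (G2 : Finset (Finset (Fin n))) (hG2 : IsGroupPartition za G2) :
    Refines G1 Gs ∧ G2.card ≤ Gz.card - 1 := by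
  have step : ∀ (i : Fin n) (hi : i.val + 1 < n), i ≤ ⟨i.val + 1, hi⟩ :=
    fun i _ => Nat.le_succ i.val
  refine ⟨hG1.1.refines_of_consecutive hGs.1 fun i hi hsame => ?_, ?_⟩
  · rw [hGs.2 i hi]
    by_contra! hlt
    have h₁ := (hG1.2 i hi).1 hsame
    have h₂ := hKKT.sub_le_of_lt i hi hlt
    have h₃ := mul_le_mul_of_nonneg_right hlam (sub_nonneg.2 (hw_anti (step i hi)))
    linarith
  · obtain ⟨i, hi, hne, hle⟩ := exists_ratio_le_of_rmin_le hn hrlam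
    have hpos : 0 < w i - w ⟨i.val + 1, hi⟩ :=
      lt_of_le_of_ne (sub_nonneg.2 (hw_anti (step i hi))) hne.symm
    have hnot : ¬ SameBlock Gz i ⟨i.val + 1, hi⟩ := fun h =>
      hne (sub_eq_zero.2 (hwG.eq_of_sameBlock h))
    have hsame : SameBlock G1 i ⟨i.val + 1, hi⟩ := by
      rw [hG1.2 i hi]
      have := (div_le_iff₀ hpos).1 hle
      linarith
    have hzG1 : Refines Gz G1 := hGz.1.refines_of_consecutive hG1.1 fun j hj h => by
      rw [hG1.2 j hj]
      beta_reduce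
      rw [hwG.eq_of_sameBlock h]
      exact sub_le_sub_right ((hGz.2 j hj).1 h) _
    have hG12 : Refines G1 G2 := hG1.1.refines_of_consecutive hG2.1 fun j hj h =>
      (hG2.2 j hj).2 (hza.eq_of_sameBlock h).le
    exact Nat.le_sub_one_of_lt
      ((hG12.card_le hG1.1 hG2.1).trans_lt (hzG1.card_lt hGz.1 hG1.1 hnot hsame))
end

section
/- Let μ₁, μ₂ ≥ 0 with (μ₁, μ₂) ≠ (0, 0), and define the weight vector w ∈ ℝⁿ by wᵢ = μ₁ + μ₂(n − i) for i = 1, …, n. Then for every x ∈ ℝⁿ, Ω_w(x) = μ₁‖x‖₁ + μ₂ Σ_{1 ≤ i < j ≤ n} max{|xᵢ|, |xⱼ|}; that is, the OWL norm with these weights equals the OSCAR norm. -/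
open Finset

/-- Summing a symmetric function over all ordered pairs counts each pair `i < j` twice. -/
theorem two_mul_sum_lt_of_symm {n : ℕ} (f : Fin n → Fin n → ℝ) (hf : ∀ i j, f i j = f j i) :
    2 * (∑ i, ∑ j, if i < j then f i j else 0) = (∑ i, ∑ j, f i j) - ∑ i, f i i := by
  have hswap : (∑ i, ∑ j, if i < j then f i j else 0) = ∑ i, ∑ j, if j < i then f i j else 0 := by
    rw [Finset.sum_comm]
    simp only [hf]
  have hdiag : ∑ i, f i i = ∑ i, ∑ j, if i = j then f i j else 0 := by simp
  rw [two_mul]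
  nth_rewrite 2 [hswap]
  rw [hdiag, eq_sub_iff_add_eq]
  simp only [← Finset.sum_add_distrib]
  refine Finset.sum_congr rfl fun i _ => Finset.sum_congr rfl fun j _ => ?_
  rcases lt_trichotomy i j with h | h | h
  · simp [h, h.not_gt, h.ne]
  · simp [h]
  · simp [h, h.not_gt, h.ne']

/-- The sum of a symmetric function over pairs `i < j` is invariant under permutations. -/
theorem sum_lt_comp_perm_of_symm {n : ℕ} (f : Fin n → Fin n → ℝ) (hf : ∀ i j, f i j = f j i)
    (σ : Equiv.Perm (Fin n)) :
    (∑ i, ∑ j, if i < j then f (σ i) (σ j) else 0) = ∑ i, ∑ j, if i < j then f i j else 0 := by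
  have h := two_mul_sum_lt_of_symm f hf
  have hσ := two_mul_sum_lt_of_symm (fun i j => f (σ i) (σ j)) fun i j => hf _ _
  have hall : ∑ i, ∑ j, f (σ i) (σ j) = ∑ i, ∑ j, f i j := by
    rw [← Equiv.sum_comp σ fun i => ∑ j, f i j]
    exact Finset.sum_congr rfl fun i _ => Equiv.sum_comp σ (f (σ i))
  have hdiag : ∑ i, f (σ i) (σ i) = ∑ i, f i i := Equiv.sum_comp σ fun i => f i i
  linarith

/-- For a monotone tuple `y`, the maximum over the pairs `i < j` is `y j`, which occurs `j` times. -/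
theorem sum_lt_max_of_monotone {n : ℕ} {y : Fin n → ℝ} (hy : Monotone y) :
    (∑ i, ∑ j, if i < j then max (y i) (y j) else 0) = ∑ j : Fin n, ((j : ℕ) : ℝ) * y j := by
  rw [Finset.sum_comm]
  refine Finset.sum_congr rfl fun j _ => ?_
  have hmax : ∀ i, (if i < j then max (y i) (y j) else 0) = if i < j then y j else 0 := by
    intro i
    split_ifs with h
    · exact max_eq_right (hy h.le)
    · rfl
  simp [hmax, ← Finset.sum_filter, Finset.filter_gt_eq_Iio]

/-- With OSCAR weights `wᵢ = μ₁ + μ₂(n − i)` (1-based `i`), the OWL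
norm equals the OSCAR norm:
`Ω_w(x) = μ₁‖x‖₁ + μ₂ Σ_{i<j} max{|xᵢ|, |xⱼ|}`. -/
theorem owl_eq_oscar {n : ℕ} (hn : 1 ≤ n) (μ1 μ2 : ℝ) (h1 : 0 ≤ μ1) (h2 : 0 ≤ μ2)
    (hne : ¬(μ1 = 0 ∧ μ2 = 0))
    (w : Fin n → ℝ) (hw : ∀ i : Fin n, w i = μ1 + μ2 * ((n : ℝ) - ((i : ℕ) + 1)))
    (x : Fin n → ℝ) :
    owl w x = μ1 * (∑ i, |x i|) +
      μ2 * ∑ i : Fin n, ∑ j : Fin n, if i < j then max |x i| |x j| else 0 := by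
  set σ := Tuple.sort fun j => |x j| with hσ
  have hmono : Monotone fun j => |x (σ j)| := Tuple.monotone_sort fun j => |x j|
  rw [← sum_lt_comp_perm_of_symm (fun i j => max |x i| |x j|) (fun i j => max_comm _ _) σ,
    sum_lt_max_of_monotone hmono, ← Equiv.sum_comp σ fun i => |x i|, owl,
    ← Equiv.sum_comp Fin.revPerm, Finset.mul_sum, Finset.mul_sum, ← Finset.sum_add_distrib]
  refine Finset.sum_congr rfl fun i _ => ?_
  have hrev : ((i.rev : ℕ) : ℝ) = n - (i + 1) := by
    rw [Fin.val_rev, Nat.cast_sub i.isLt]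
    push_cast
    ring
  rw [Fin.revPerm_apply, Fin.rev_rev, hw, hrev, ← hσ]
  ring
end
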